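/- Let a >= 2 be an integer and define the sets A_u = { p*a + (p+2)^2 : p in {1, ..., a-1} }, A_v = { p*a + (p+1)^2 + 2 : p in {1, ..., a} }, and A_w = { p*a + p^2 + 2 : p in {1, ..., a+1} }. Then the sets A_u, A_v and A_w are pairwise disjoint if and only if a is even. -/

import Mathlib

/-- `n ↦ n * a + n ^ 2` is strictly increasing, so it reflects the strict order. -/
theorem lt_of_mul_add_sq_lt {a m n : ℕ} (h : m * a + m ^ 2 < n * a + n ^ 2) : m < n := by
  by_contra! hnm
  have hmul : n * a ≤ m * a := by gcongr
  have hsq : n ^ 2 ≤ m ^ 2 := by gcongr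
  omega

/-- For `a ≥ 2`, the sets `A_u = {p·a + (p+2)² : p ∈ [a-1]}`,
`A_v = {p·a + (p+1)² + 2 : p ∈ [a]}` and `A_w = {p·a + p² + 2 : p ∈ [a+1]}` are
pairwise disjoint if and only if `a` is even. -/
theorem stmt_18 (a : ℕ) (ha : 2 ≤ a) :
    (Disjoint {x : ℕ | ∃ p : ℕ, 1 ≤ p ∧ p ≤ a - 1 ∧ x = p * a + (p + 2) ^ 2}
        {x : ℕ | ∃ p : ℕ, 1 ≤ p ∧ p ≤ a ∧ x = p * a + (p + 1) ^ 2 + 2} ∧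
      Disjoint {x : ℕ | ∃ p : ℕ, 1 ≤ p ∧ p ≤ a - 1 ∧ x = p * a + (p + 2) ^ 2}
        {x : ℕ | ∃ p : ℕ, 1 ≤ p ∧ p ≤ a + 1 ∧ x = p * a + p ^ 2 + 2} ∧
      Disjoint {x : ℕ | ∃ p : ℕ, 1 ≤ p ∧ p ≤ a ∧ x = p * a + (p + 1) ^ 2 + 2}
        {x : ℕ | ∃ p : ℕ, 1 ≤ p ∧ p ≤ a + 1 ∧ x = p * a + p ^ 2 + 2}) ↔
    Even a := by
  simp only [Set.disjoint_left, Set.mem_ofPred_eq]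
  constructor
  · rintro ⟨-, huw, -⟩
    by_contra hodd
    obtain ⟨k, rfl⟩ := Nat.not_even_iff_odd.mp hodd
    exact huw ⟨k, by omega, by omega, rfl⟩ ⟨k + 1, by omega, by omega, by ring⟩
  · intro heven
    refine ⟨?_, ?_, ?_⟩
    · rintro x ⟨p, -, -, rfl⟩ ⟨q, -, -, h⟩
      have hlow : p < q := lt_of_mul_add_sq_lt (a := a + 2) (by nlinarith)
      have hupp : q < p + 1 := lt_of_mul_add_sq_lt (a := a + 2) (by nlinarith)
      omega
    · rintro x ⟨p, -, -, rfl⟩ ⟨r, -, -, h⟩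
      have hlow : p < r := lt_of_mul_add_sq_lt (a := a) (by nlinarith)
      have hupp : r < p + 2 := lt_of_mul_add_sq_lt (a := a) (by nlinarith)
      obtain rfl : r = p + 1 := by omega
      have : a = 2 * p + 1 := by linarith
      grind
    · rintro x ⟨q, -, -, rfl⟩ ⟨r, -, -, h⟩
      have hlow : q < r := lt_of_mul_add_sq_lt (a := a) (by nlinarith)
      have hupp : r < q + 1 := lt_of_mul_add_sq_lt (a := a) (by nlinarith)
      omega
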